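/- arXiv:1807.05314 — 4 statements merged into one kernel-verified Lean document; each statement's English description precedes it below -/
import Mathlib

section
/- Let I, J, K be finite types, let Λ : I → ℝ, Λ' : J → ℝ, Σ : K → ℝ be probability vectors, and let S : K → I → ℝ and S' : K → J → ℝ be stochastic matrices with S · Λ = Σ and S' · Λ' = Σ. Define ℐ : (I × J) → I → ℝ by ℐ (b,b') a = (if a = b then Λ' b' else 0) and ℐ' : (I × J) → J → ℝ by ℐ' (b,b') a' = (if a' = b' then Λ b else 0), and define S̃ : K → (I × J) → ℝ by S̃ k (a,a') = (Σ k)⁻¹ * S k a * S' k a' when Σ k ≠ 0, and S̃ k (a,a') = S k a + S' k a' when Σ k = 0. Then: (i) ℐ and ℐ' are stochastic matrices sending Λ (resp. Λ') to the product vector (Λ ⊗ Λ')(a,a') = Λ a * Λ' a'; (ii) ∑_{(a,a')} S̃ k (a,a') * Λ a * Λ' a' = Σ k for every k; (iii) the matrix product satisfies (S̃ * ℐ) k b = S k b for all k, b; and (iv) (S̃ * ℐ') k b' = S' k b' for all k, b'. -/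
/-- The first inclusion `ℐ : (I × J) → I → ℝ`, `ℐ (b,b') a = (if a = b then Λ' b' else 0)`. -/
def iota₁ {I J : Type*} [DecidableEq I] (Λ' : J → ℝ) : I × J → I → ℝ :=
  fun p a => if a = p.1 then Λ' p.2 else 0

/-- The second inclusion `ℐ' : (I × J) → J → ℝ`, `ℐ' (b,b') a' = (if a' = b' then Λ b else 0)`. -/
def iota₂ {I J : Type*} [DecidableEq J] (Λ : I → ℝ) : I × J → J → ℝ :=
  fun p a' => if a' = p.2 then Λ p.1 else 0

/-- The coproduct morphism `S̃ : K → (I × J) → ℝ` built out of `S` and `S'`. -/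
noncomputable def coprodMor {I J K : Type*} (Sig : K → ℝ) (S : K → I → ℝ) (S' : K → J → ℝ) :
    K → I × J → ℝ :=
  fun k p => if Sig k = 0 then S k p.1 + S' k p.2 else (Sig k)⁻¹ * S k p.1 * S' k p.2

/-- Universal property of the coproduct (product of statistically independent
distributions) in the category of finite probabilities with stochastic maps:
(i) the inclusions `ℐ`, `ℐ'` are stochastic matrices sending `Λ` (resp. `Λ'`) to the
product vector `Λ ⊗ Λ'`; (ii) `S̃` pushes `Λ ⊗ Λ'` to `Σ`; (iii) `S̃ * ℐ = S`;
(iv) `S̃ * ℐ' = S'`. -/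
theorem coproduct_universal_property {I J K : Type*} [Fintype I] [Fintype J] [Fintype K]
    [DecidableEq I] [DecidableEq J]
    (Λ : I → ℝ) (Λ' : J → ℝ) (Sig : K → ℝ)
    (hΛ0 : ∀ i, 0 ≤ Λ i) (hΛ1 : ∑ i, Λ i = 1)
    (hΛ'0 : ∀ j, 0 ≤ Λ' j) (hΛ'1 : ∑ j, Λ' j = 1)
    (hSig0 : ∀ k, 0 ≤ Sig k) (hSig1 : ∑ k, Sig k = 1)
    (S : K → I → ℝ) (S' : K → J → ℝ)
    (hS0 : ∀ k i, 0 ≤ S k i) (hScol : ∀ i, ∑ k, S k i = 1)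
    (hSpush : ∀ k, ∑ i, S k i * Λ i = Sig k)
    (hS'0 : ∀ k j, 0 ≤ S' k j) (hS'col : ∀ j, ∑ k, S' k j = 1)
    (hS'push : ∀ k, ∑ j, S' k j * Λ' j = Sig k) :
    -- (i) ℐ and ℐ' are stochastic matrices sending Λ, Λ' to the product Λ ⊗ Λ'
    ((∀ (p : I × J) (a : I), 0 ≤ iota₁ Λ' p a) ∧
      (∀ a : I, ∑ p : I × J, iota₁ Λ' p a = 1) ∧
      (∀ p : I × J, ∑ a : I, iota₁ Λ' p a * Λ a = Λ p.1 * Λ' p.2)) ∧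
    ((∀ (p : I × J) (a' : J), 0 ≤ iota₂ Λ p a') ∧
      (∀ a' : J, ∑ p : I × J, iota₂ Λ p a' = 1) ∧
      (∀ p : I × J, ∑ a' : J, iota₂ Λ p a' * Λ' a' = Λ p.1 * Λ' p.2)) ∧
    -- (ii) S̃ pushes the product vector Λ ⊗ Λ' to Σ
    (∀ k, ∑ p : I × J, coprodMor Sig S S' k p * (Λ p.1 * Λ' p.2) = Sig k) ∧
    -- (iii) S̃ * ℐ = S
    (∀ k (b : I), ∑ p : I × J, coprodMor Sig S S' k p * iota₁ Λ' p b = S k b) ∧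
    -- (iv) S̃ * ℐ' = S'
    (∀ k (b' : J), ∑ p : I × J, coprodMor Sig S S' k p * iota₂ Λ p b' = S' k b') := by
  have h3 : ∀ k (b : I), ∑ j, coprodMor Sig S S' k (b, j) * Λ' j = S k b := by
    intro k b
    by_cases h : Sig k = 0
    · simp only [coprodMor, h, if_true, add_mul, Finset.sum_add_distrib, ← Finset.mul_sum,
        hΛ'1, hS'push]
      ring
    · simp only [coprodMor, h, if_false, mul_assoc, ← Finset.mul_sum, hS'push]
      field_simp
  have h4 : ∀ k (b : J), ∑ i, coprodMor Sig S S' k (i, b) * Λ i = S' k b := by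
    intro k b
    by_cases h : Sig k = 0
    · simp only [coprodMor, h, if_true, add_mul, Finset.sum_add_distrib, ← Finset.mul_sum,
        hΛ1, hSpush]
      ring
    · have e : ∀ i, coprodMor Sig S S' k (i, b) * Λ i
          = ((Sig k)⁻¹ * S' k b) * (S k i * Λ i) := by
        intro i
        simp only [coprodMor, h, if_false]
        ring
      simp only [e, ← Finset.mul_sum, hSpush]
      field_simp
  refine ⟨⟨?_, ?_, ?_⟩, ⟨?_, ?_, ?_⟩, ?_, ?_, ?_⟩
  · intro p a
    unfold iota₁
    split_ifs
    · exact hΛ'0 _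
    · exact le_rfl
  · intro a
    rw [Fintype.sum_prod_type_right]
    simp [iota₁, hΛ'1]
  · intro p
    simp [iota₁, mul_comm]
  · intro p a
    unfold iota₂
    split_ifs
    · exact hΛ0 _
    · exact le_rfl
  · intro a
    rw [Fintype.sum_prod_type]
    simp [iota₂, hΛ1]
  · intro p
    simp [iota₂]
  · intro k
    rw [Fintype.sum_prod_type, ← hSpush k]
    refine Finset.sum_congr rfl fun i _ => ?_
    rw [← h3 k i, Finset.sum_mul]
    refine Finset.sum_congr rfl fun j _ => ?_
    ring
  · intro k b
    rw [Fintype.sum_prod_type_right, ← h3 k b]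
    simp [iota₁]
  · intro k b
    rw [Fintype.sum_prod_type, ← h4 k b]
    simp [iota₂]
end

section
/- Suppose ℋ assigns a real number to every stochastic morphism S from a finite probability (X, P) to a finite probability (Y, Q), such that: (continuity) for each pair of finite types X, Y, ℋ is continuous as a function of the triple (P, Q, S) on the set of valid morphisms; (1) ℋ(S) = 0 whenever S is an isomorphism (a permutation matrix); (2) ℋ(S' * S) = ℋ(S') + ℋ(S) for composable morphisms; (3) for S from (X, P) to (Y, Q), S' from (X', P') to (Y, Q) and λ ∈ [0,1], the block-matrix morphism [S | S'] from (X ⊔ X', λP ⊕ (1−λ)P') to (Y, Q) satisfies ℋ([S | S']) = λ ℋ(S) + (1−λ) ℋ(S') + ℋ(1̂_{(λ,1−λ)}), where 1̂_{(λ,1−λ)} is the unique stochastic morphism from the two-point probability (λ, 1−λ) to the one-point probability. Then there exists a constant C ∈ ℝ such that for every stochastic morphism S from (X, P) to (Y, Q), ℋ(S) = C * (H(Q) − H(P)), where H is the Shannon entropy. -/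
/-- A valid morphism of finite probabilities: `P` and `Q` are probability vectors and
`S` is a stochastic matrix pushing `P` forward to `Q`. -/
def IsStochMor {X Y : Type*} [Fintype X] [Fintype Y]
    (P : X → ℝ) (Q : Y → ℝ) (S : Y → X → ℝ) : Prop :=
  (∀ x, 0 ≤ P x) ∧ (∑ x, P x = 1) ∧ (∀ y, 0 ≤ Q y) ∧ (∑ y, Q y = 1) ∧
  (∀ x y, 0 ≤ S y x) ∧ (∀ x, ∑ y, S y x = 1) ∧ (∀ y, ∑ x, S y x * P x = Q y)

open Filter Topology in
theorem fad_erdos (f : ℕ → ℝ) (hmul : ∀ m n, 1 ≤ m → 1 ≤ n → f (m * n) = f m + f n)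
    (h2 : f 2 = 0) (hd : Tendsto (fun n => f (n + 1) - f n) atTop (𝓝 0)) :
    ∀ n, 1 ≤ n → f n = 0 := by
  have key : ∀ ε : ℝ, 0 < ε → ∃ K : ℝ, ∀ n, 1 ≤ n → |f n| ≤ ε * Real.log n + K := by
    intro ε hε
    have hl2 : 0 < Real.log 2 := Real.log_pos (by norm_num)
    obtain ⟨N, hN⟩ := (Metric.tendsto_atTop.1 hd) (ε * Real.log 2) (by positivity)
    refine ⟨∑ k ∈ Finset.range (N + 2), |f k|, ?_⟩
    intro n
    induction n using Nat.strong_induction_on with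
    | _ n ih =>
      intro hn
      by_cases hlt : n < N + 2
      · have h1 : |f n| ≤ ∑ k ∈ Finset.range (N + 2), |f k| :=
          Finset.single_le_sum (f := fun k => |f k|) (fun _ _ => abs_nonneg _)
            (Finset.mem_range.2 hlt)
        have h3 : 0 ≤ Real.log n := Real.log_natCast_nonneg n
        have := mul_nonneg hε.le h3
        linarith
      · obtain ⟨k, hk⟩ : ∃ k, n = 2 * k ∨ n = 2 * k + 1 := ⟨n / 2, by omega⟩
        have hk1 : 1 ≤ k := by omega
        have ihk := ih k (by omega) hk1
        have h2k : f (2 * k) = f k := by rw [hmul 2 k (by norm_num) hk1, h2, zero_add]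
        have hle : |f n| ≤ ε * Real.log 2 + |f k| := by
          rcases hk with hk | hk
          · rw [hk, h2k]
            have := mul_pos hε hl2
            linarith
          · have := hN (2 * k) (by omega)
            rw [Real.dist_eq, sub_zero, h2k, ← hk] at this
            have h5 := abs_sub_abs_le_abs_sub (f n) (f k)
            linarith
        have hlog : Real.log 2 + Real.log k ≤ Real.log n := by
          have hkp : (0 : ℝ) < k := by exact_mod_cast hk1
          rw [← Real.log_mul (by norm_num) hkp.ne']
          apply Real.log_le_log (by positivity)
          have : 2 * k ≤ n := by omega
          exact_mod_cast this
        have := mul_le_mul_of_nonneg_left hlog hε.le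
        linarith
  have hpow : ∀ n : ℕ, 1 ≤ n → ∀ k : ℕ, 1 ≤ k → f (n ^ k) = k * f n := by
    intro n hn k hk
    induction k, hk using Nat.le_induction with
    | base => simp
    | succ k hk ih =>
      rw [pow_succ, hmul _ _ (Nat.one_le_pow _ _ hn) hn, ih]
      push_cast; ring
  intro n hn
  have hbd : ∀ ε : ℝ, 0 < ε → |f n| ≤ ε * Real.log n := by
    intro ε hε
    obtain ⟨K, hK⟩ := key ε hε
    by_contra! hcon
    obtain ⟨k, hk⟩ := exists_nat_gt (K / (|f n| - ε * Real.log n))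
    have hpos : 0 < |f n| - ε * Real.log n := by linarith
    rw [div_lt_iff₀ hpos] at hk
    have h1 := hK (n ^ (k + 1)) (Nat.one_le_pow _ _ hn)
    rw [hpow n hn (k + 1) (by omega), abs_mul] at h1
    push_cast at h1
    rw [Real.log_pow, abs_of_nonneg (by positivity : (0 : ℝ) ≤ (k : ℝ) + 1)] at h1
    push_cast at h1
    nlinarith
  have h0 : |f n| ≤ 0 := by
    apply le_of_forall_pos_le_add
    intro δ hδ
    have hl : 0 ≤ Real.log n := Real.log_natCast_nonneg n
    have h1 := hbd (δ / (Real.log n + 1)) (by positivity)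
    have h2 : δ / (Real.log n + 1) * Real.log n ≤ δ := by
      rw [div_mul_eq_mul_div, div_le_iff₀ (by positivity)]
      nlinarith
    linarith
  exact abs_eq_zero.1 (le_antisymm h0 (abs_nonneg _))

open Filter Topology in
theorem fad_numbers (L : ℕ → ℝ) (g : ℝ → ℝ) (hg : ContinuousOn g (Set.Icc 0 1)) (hg0 : g 0 = 0)
    (hL1 : L 1 = 0)
    (hU : ∀ m n : ℕ, 1 ≤ m → 1 ≤ n → L (m + n) =
      ((m : ℝ) / (m + n)) * L m + (1 - (m : ℝ) / (m + n)) * L n + g ((m : ℝ) / (m + n))) :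
    ∃ c : ℝ, ∀ t ∈ Set.Icc (0 : ℝ) 1, g t = c * (Real.negMulLog t + Real.negMulLog (1 - t)) := by
  have hmul : ∀ m n, 1 ≤ m → 1 ≤ n → L (m * n) = L m + L n := by
    intro m n hm hn
    induction m, hm using Nat.le_induction with
    | base => simp [hL1]
    | succ k hk ih =>
      have hk0 : (0 : ℝ) < k := by exact_mod_cast hk
      have hn0 : (0 : ℝ) < n := by exact_mod_cast hn
      have e1 := hU (k * n) n (Nat.mul_pos hk hn) hn
      have e2 := hU k 1 hk le_rfl
      have e3 : ((k * n : ℕ) : ℝ) / ((k * n : ℕ) + n) = (k : ℝ) / (k + (1 : ℕ)) := by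
        push_cast; field_simp
      rw [e3, ih] at e1
      rw [add_mul, one_mul, e1, e2, hL1]
      ring
  have hstep : ∀ n, 1 ≤ n → L (n + 1) = (1 - 1 / ((n : ℝ) + 1)) * L n + g (1 / ((n : ℝ) + 1)) := by
    intro n hn
    have := hU 1 n le_rfl hn
    rw [hL1] at this
    push_cast at this
    rw [add_comm n 1, this, add_comm (1 : ℝ) n]
    ring
  have hgl : Tendsto (fun n : ℕ => g (1 / ((n : ℝ) + 1))) atTop (𝓝 0) := by
    have h0 : Tendsto g (𝓝[Set.Icc 0 1] 0) (𝓝 (g 0)) := hg 0 (by simp)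
    rw [hg0] at h0
    refine h0.comp (tendsto_nhdsWithin_iff.2 ⟨tendsto_one_div_add_atTop_nhds_zero_nat, ?_⟩)
    refine Eventually.of_forall fun n => ⟨by positivity, ?_⟩
    rw [div_le_one (by positivity)]
    have : (0 : ℝ) ≤ n := n.cast_nonneg
    linarith
  have hbound : ∀ n, 1 ≤ n → |L n| ≤ ∑ k ∈ Finset.range n, |g (1 / ((k : ℝ) + 1))| := by
    intro n hn
    induction n, hn using Nat.le_induction with
    | base => simp [hL1]
    | succ n hn ih =>
      rw [Finset.sum_range_succ, hstep n hn]
      refine (abs_add_le _ _).trans (add_le_add_left (le_trans ?_ ih) _)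
      rw [abs_mul]
      have h1 : 0 < 1 / ((n : ℝ) + 1) := by positivity
      have h2 : 1 / ((n : ℝ) + 1) ≤ 1 := by
        rw [div_le_one (by positivity)]
        have : (0 : ℝ) ≤ n := n.cast_nonneg
        linarith
      rw [abs_of_nonneg (by linarith)]
      nlinarith [abs_nonneg (L n)]
  have hd : Tendsto (fun n => L (n + 1) - L n) atTop (𝓝 0) := by
    have hces := (hgl.abs).cesaro
    rw [abs_zero] at hces
    have hsum := hgl.abs.add hces
    rw [abs_zero, add_zero] at hsum
    refine squeeze_zero_norm' ?_ hsum
    filter_upwards [eventually_ge_atTop 1] with n hn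
    have hn0 : (0 : ℝ) < n := by exact_mod_cast hn
    have e : L (n + 1) - L n = g (1 / ((n : ℝ) + 1)) - 1 / ((n : ℝ) + 1) * L n := by
      rw [hstep n hn]; ring
    rw [e, Real.norm_eq_abs]
    refine (abs_sub _ _).trans (add_le_add_right ?_ _)
    rw [abs_mul, abs_of_pos (by positivity : 0 < 1 / ((n : ℝ) + 1))]
    have h3 : 1 / ((n : ℝ) + 1) ≤ (n : ℝ)⁻¹ := by
      rw [one_div]; exact inv_anti₀ hn0 (by linarith)
    exact mul_le_mul h3 (hbound n hn) (abs_nonneg _) (by positivity)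
  have hl2 : 0 < Real.log 2 := Real.log_pos (by norm_num)
  have hlogd : Tendsto (fun n : ℕ => Real.log ((n + 1 : ℕ) : ℝ) - Real.log n) atTop (𝓝 0) := by
    have := Real.tendsto_log_nat_add_one_sub_log
    simpa using this
  set c := L 2 / Real.log 2 with hc
  have hL : ∀ n, 1 ≤ n → L n = c * Real.log n := by
    intro n hn
    have := fad_erdos (fun n => L n - c * Real.log n) ?_ ?_ ?_ n hn
    · simpa [sub_eq_zero] using this
    · intro a b ha hb
      have ha0 : (a : ℝ) ≠ 0 := by exact_mod_cast (by omega : a ≠ 0)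
      have hb0 : (b : ℝ) ≠ 0 := by exact_mod_cast (by omega : b ≠ 0)
      simp only [hmul a b ha hb, Nat.cast_mul, Real.log_mul ha0 hb0]
      ring
    · simp only [hc, Nat.cast_ofNat]
      field_simp
      ring
    · have := hd.sub (hlogd.const_mul c)
      simp only [mul_zero, sub_zero] at this
      refine this.congr fun n => ?_
      ring
  refine ⟨c, ?_⟩
  have heq : Set.EqOn g (fun t => c * (Real.negMulLog t + Real.negMulLog (1 - t)))
      (Set.Ioo 0 1 ∩ Set.range ((↑) : ℚ → ℝ)) := by
    rintro _ ⟨⟨h0, h1⟩, q, rfl⟩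
    have hq0 : 0 < q := by exact_mod_cast h0
    have hq1 : q < 1 := by exact_mod_cast h1
    obtain ⟨m, hm⟩ := Int.eq_ofNat_of_zero_le (Rat.num_pos.2 hq0).le
    have hmp : 1 ≤ m := by have := Rat.num_pos.2 hq0; omega
    have hmd : m < q.den := by
      have := Rat.num_lt_denom_iff.2 hq1
      omega
    obtain ⟨k, hk⟩ := Nat.exists_eq_add_of_lt hmd
    have hqe : (q : ℝ) = (m : ℝ) / ((m : ℝ) + (k + 1 : ℕ)) := by
      rw [Rat.cast_def, hm, hk]
      push_cast
      ring
    have hu := hU m (k + 1) hmp (by omega)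
    rw [← hqe, hL m hmp, hL (k + 1) (by omega), hL (m + (k + 1)) (by omega)] at hu
    have hm0 : (0 : ℝ) < m := by exact_mod_cast hmp
    have hk0 : (0 : ℝ) < (k + 1 : ℕ) := by positivity
    have hs0 : (0 : ℝ) < (m : ℝ) + (k + 1 : ℕ) := by positivity
    have l1 : Real.log q = Real.log m - Real.log ((m : ℝ) + (k + 1 : ℕ)) := by
      rw [hqe, Real.log_div hm0.ne' hs0.ne']
    have l2 : Real.log (1 - q) = Real.log (k + 1 : ℕ) - Real.log ((m : ℝ) + (k + 1 : ℕ)) := by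
      rw [← Real.log_div hk0.ne' hs0.ne', hqe]
      congr 1
      field_simp
      ring
    simp only [Real.negMulLog, l1, l2]
    rw [Nat.cast_add m (k + 1)] at hu
    linear_combination -hu
  refine heq.of_subset_closure hg ?_ (fun t ht => ⟨ht.1.1.le, ht.1.2.le⟩) ?_
  · exact (continuous_const.mul (Real.continuous_negMulLog.add
      (Real.continuous_negMulLog.comp (continuous_const.sub continuous_id)))).continuousOn
  · have h1 : Set.Ioo (0 : ℝ) 1 ⊆ closure (Set.Ioo 0 1 ∩ Set.range ((↑) : ℚ → ℝ)) :=
      Rat.denseRange_cast.open_subset_closure_inter isOpen_Ioo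
    have h2 := closure_minimal h1 isClosed_closure
    rwa [closure_Ioo (by norm_num)] at h2

theorem fad_main (G : ∀ (X : Type) [Fintype X], (X → ℝ) → ℝ)
    (hpt : G PUnit (fun _ => 1) = 0)
    (heq : ∀ (X Y : Type) [Fintype X] [Fintype Y] (e : X ≃ Y) (P : X → ℝ) (Q : Y → ℝ),
      (∀ x, 0 ≤ P x) → ∑ x, P x = 1 → (∀ x, Q (e x) = P x) → G X P = G Y Q)
    (hc : ContinuousOn (fun l : ℝ => G Bool (fun b => if b then l else 1 - l)) (Set.Icc 0 1))
    (hmix : ∀ (X X' : Type) [Fintype X] [Fintype X'] (P : X → ℝ) (P' : X' → ℝ) (l : ℝ),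
      0 ≤ l → l ≤ 1 → (∀ x, 0 ≤ P x) → ∑ x, P x = 1 → (∀ x, 0 ≤ P' x) → ∑ x, P' x = 1 →
      G (X ⊕ X') (Sum.elim (fun x => l * P x) (fun x' => (1 - l) * P' x'))
        = l * G X P + (1 - l) * G X' P' + G Bool (fun b => if b then l else 1 - l)) :
    ∃ c : ℝ, ∀ (X : Type) [Fintype X] (P : X → ℝ), (∀ x, 0 ≤ P x) → ∑ x, P x = 1 →
      G X P = c * ∑ x, Real.negMulLog (P x) := by
  set g : ℝ → ℝ := fun l : ℝ => G Bool (fun b => if b then l else 1 - l) with hgdef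
  have hmix' : ∀ (X X' Z : Type) [Fintype X] [Fintype X'] [Fintype Z] (e : X ⊕ X' ≃ Z)
      (P : X → ℝ) (P' : X' → ℝ) (R : Z → ℝ) (l : ℝ),
      0 ≤ l → l ≤ 1 → (∀ x, 0 ≤ P x) → ∑ x, P x = 1 → (∀ x, 0 ≤ P' x) → ∑ x, P' x = 1 →
      (∀ x, R (e (Sum.inl x)) = l * P x) → (∀ x, R (e (Sum.inr x)) = (1 - l) * P' x) →
      G Z R = l * G X P + (1 - l) * G X' P' + g l := by
    intro X X' Z _ _ _ e P P' R l h0 h1 hP hP1 hP' hP1' hl hr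
    rw [← heq (X ⊕ X') Z e (Sum.elim (fun x => l * P x) (fun x' => (1 - l) * P' x')) R ?_ ?_ ?_,
      hmix X X' P P' l h0 h1 hP hP1 hP' hP1']
    · rintro (x | x)
      · exact mul_nonneg h0 (hP x)
      · exact mul_nonneg (by linarith) (hP' x)
    · simp [← Finset.mul_sum, hP1, hP1']
    · rintro (x | x)
      · exact hl x
      · exact hr x
  have hb : ∀ l : ℝ, 0 ≤ l → l ≤ 1 → ∀ b : Bool, 0 ≤ (if b then l else 1 - l) := by
    intro l h0 h1 b
    split_ifs <;> linarith
  have hg0 : g 0 = 0 := by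
    let R : PUnit.{1} ⊕ Bool → ℝ := Sum.elim (fun _ => 0) (fun b => if b then 0 else 1)
    have e1 := hmix' PUnit Bool (PUnit ⊕ Bool) (Equiv.refl _) (fun _ => 1)
      (fun b => if b then 0 else 1 - 0) R 0 le_rfl zero_le_one (by simp) (by simp)
      (hb 0 le_rfl zero_le_one) (by simp) (by simp [R]) (by simp [R])
    let e : Bool ⊕ PUnit.{1} ≃ PUnit.{1} ⊕ Bool :=
      { toFun := Sum.elim (fun b => if b then Sum.inl PUnit.unit else Sum.inr true)
          (fun _ => Sum.inr false)
        invFun := Sum.elim (fun _ => Sum.inl true)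
          (fun b => if b then Sum.inl false else Sum.inr PUnit.unit)
        left_inv := by rintro ((_ | _) | _) <;> simp
        right_inv := by rintro (_ | _ | _) <;> simp }
    have e2 := hmix' Bool PUnit (PUnit ⊕ Bool) e (fun b => if b then 0 else 1 - 0)
      (fun _ => 1) R 0 le_rfl zero_le_one
      (hb 0 le_rfl zero_le_one) (by simp) (by simp) (by simp)
      (by rintro (_ | _) <;> simp [R, e]) (by simp [R, e])
    have e3 : G Bool (fun b => if b then 0 else 1 - 0) = g 0 := rfl
    rw [e3, hpt] at e1 e2
    linarith
  obtain ⟨c, hcc⟩ := fad_numbers (fun n => G (Fin n) (fun _ => 1 / (n : ℝ))) g hc hg0 (by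
      rw [← hpt]
      exact heq (Fin 1) PUnit (Equiv.equivPUnit _) _ _ (by simp) (by simp) (by simp)) (by
      intro m n hm hn
      have hm0 : (0 : ℝ) < m := by exact_mod_cast hm
      have hn0 : (0 : ℝ) < n := by exact_mod_cast hn
      refine hmix' (Fin m) (Fin n) (Fin (m + n)) finSumFinEquiv _ _ _ _ (by positivity) ?_
        (fun _ => by positivity) ?_ (fun _ => by positivity) ?_ ?_ ?_
      · rw [div_le_one (by positivity)]; linarith
      · simp [hm0.ne']
      · simp [hn0.ne']
      · intro x; push_cast; field_simp
      · intro x; push_cast; field_simp; ring)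
  refine ⟨c, ?_⟩
  have hfin : ∀ n : ℕ, ∀ P : Fin n → ℝ, (∀ x, 0 ≤ P x) → ∑ x, P x = 1 →
      G (Fin n) P = c * ∑ x, Real.negMulLog (P x) := by
    intro n
    induction n with
    | zero => intro P _ h; simp at h
    | succ n ih =>
      intro P hP hP1
      rw [Fin.sum_univ_succ] at hP1 ⊢
      have htail : ∀ i : Fin n, 0 ≤ P i.succ := fun i => hP _
      have hs0 : 0 ≤ ∑ i : Fin n, P i.succ := Finset.sum_nonneg fun i _ => htail i
      rcases Nat.eq_zero_or_pos n with hn | hn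
      · subst hn
        have hP0 : P 0 = 1 := by simpa using hP1
        have : G (Fin (0 + 1)) P = G PUnit (fun _ => 1) := by
          refine heq (Fin 1) PUnit (Equiv.equivPUnit _) P _ hP (by simp [hP0]) ?_
          intro x
          rw [Subsingleton.elim x 0, hP0]
        rw [this, hpt, hP0]
        simp
      · have hn0 : (0 : ℝ) < n := by exact_mod_cast hn
        obtain ⟨l, hl⟩ : ∃ l, l = ∑ i : Fin n, P i.succ := ⟨_, rfl⟩
        obtain ⟨P', hP', hP1', hPe⟩ : ∃ P' : Fin n → ℝ, (∀ i, 0 ≤ P' i) ∧ ∑ i, P' i = 1 ∧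
            ∀ i, P i.succ = l * P' i := by
          by_cases h : l = 0
          · refine ⟨fun _ => 1 / n, fun _ => by positivity, by simp [hn0.ne'], fun i => ?_⟩
            rw [h, zero_mul]
            exact (Finset.sum_eq_zero_iff_of_nonneg (fun i _ => htail i)).1 (hl ▸ h) i
              (Finset.mem_univ i)
          · refine ⟨fun i => P i.succ / l, fun i => div_nonneg (htail i) (hl ▸ hs0), ?_,
              fun i => by field_simp⟩
            rw [← Finset.sum_div, ← hl, div_self h]
        have hP0 : P 0 = 1 - l := by linarith
        have hl0 : 0 ≤ l := hl ▸ hs0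
        have hl1 : l ≤ 1 := by have := hP 0; linarith
        rw [hmix' (Fin n) PUnit (Fin (n + 1))
          ((Equiv.optionEquivSumPUnit (Fin n)).symm.trans (finSuccEquiv n).symm)
          P' (fun _ => 1) P l hl0 hl1 hP' hP1' (by simp) (by simp)
          (by intro x; simp [hPe]) (by intro x; simp [hP0]), hpt, ih P' hP' hP1', hcc l ⟨hl0, hl1⟩]
        simp only [hPe, hP0, Real.negMulLog_mul, Finset.sum_add_distrib, ← Finset.sum_mul,
          ← Finset.mul_sum, hP1']
        ring
  intro X _ P hP hP1
  have e := Fintype.equivFin X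
  have h1 : ∑ i, P (e.symm i) = 1 := by rw [← hP1]; exact Equiv.sum_comp e.symm P
  rw [heq X _ e P (fun i => P (e.symm i)) hP hP1 (by simp), hfin _ _ (fun i => hP _) h1]
  congr 1
  exact Equiv.sum_comp e.symm (fun x => Real.negMulLog (P x))

/-- Axiomatic characterization of the information loss functional: any continuous
functional `ℋ` on stochastic morphisms of finite probabilities that vanishes on
isomorphisms, is additive under composition, and satisfies the convex-combination
property is a constant multiple of the difference of Shannon entropies,
`ℋ(S) = C (H(Q) − H(P))`. -/
theorem information_loss_characterization
    (IL : ∀ (X Y : Type) [Fintype X] [Fintype Y],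
      (X → ℝ) → (Y → ℝ) → (Y → X → ℝ) → ℝ)
    -- continuity on the set of valid morphisms, for each pair of finite types
    (hcont : ∀ (X Y : Type) [Fintype X] [Fintype Y],
      ContinuousOn
        (fun t : (X → ℝ) × (Y → ℝ) × (Y → X → ℝ) => IL X Y t.1 t.2.1 t.2.2)
        {t : (X → ℝ) × (Y → ℝ) × (Y → X → ℝ) | IsStochMor t.1 t.2.1 t.2.2})
    -- (1) vanishing on isomorphisms
    (hiso : ∀ (X Y : Type) [Fintype X] [Fintype Y] [DecidableEq X] [DecidableEq Y]
      (P : X → ℝ) (Q : Y → ℝ) (S : Y → X → ℝ), IsStochMor P Q S →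
      (∃ T : X → Y → ℝ, IsStochMor Q P T ∧
        (∀ x x', ∑ y, T x y * S y x' = if x = x' then (1 : ℝ) else 0) ∧
        (∀ y y', ∑ x, S y x * T x y' = if y = y' then (1 : ℝ) else 0)) →
      IL X Y P Q S = 0)
    -- (2) additivity under composition
    (hcomp : ∀ (X Y Z : Type) [Fintype X] [Fintype Y] [Fintype Z]
      (P : X → ℝ) (Q : Y → ℝ) (R : Z → ℝ) (S : Y → X → ℝ) (S' : Z → Y → ℝ),
      IsStochMor P Q S → IsStochMor Q R S' →
      IL X Z P R (fun z x => ∑ y, S' z y * S y x) = IL Y Z Q R S' + IL X Y P Q S)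
    -- (3) the convex-combination (block matrix) property
    (hmix : ∀ (X X' Y : Type) [Fintype X] [Fintype X'] [Fintype Y]
      (P : X → ℝ) (P' : X' → ℝ) (Q : Y → ℝ) (S : Y → X → ℝ) (S' : Y → X' → ℝ)
      (l : ℝ), 0 ≤ l → l ≤ 1 → IsStochMor P Q S → IsStochMor P' Q S' →
      IL (X ⊕ X') Y (Sum.elim (fun x => l * P x) (fun x' => (1 - l) * P' x')) Q
          (fun y => Sum.elim (S y) (S' y))
        = l * IL X Y P Q S + (1 - l) * IL X' Y P' Q S'
          + IL Bool PUnit (fun b => if b then l else 1 - l)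
              (fun _ => 1) (fun _ _ => 1)) :
    ∃ C : ℝ, ∀ (X Y : Type) [Fintype X] [Fintype Y]
      (P : X → ℝ) (Q : Y → ℝ) (S : Y → X → ℝ), IsStochMor P Q S →
      IL X Y P Q S
        = C * ((∑ y, Real.negMulLog (Q y)) - ∑ x, Real.negMulLog (P x)) := by
  have hone : ∀ (X : Type) [Fintype X] (P : X → ℝ), (∀ x, 0 ≤ P x) → ∑ x, P x = 1 →
      IsStochMor P (fun _ : PUnit.{1} => (1 : ℝ)) (fun _ _ => 1) := by
    intro X _ P hP hP1
    exact ⟨hP, hP1, by simp, by simp, by simp, by simp, by simp [hP1]⟩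
  have hdiff : ∀ (X Y : Type) [Fintype X] [Fintype Y]
      (P : X → ℝ) (Q : Y → ℝ) (S : Y → X → ℝ), IsStochMor P Q S →
      IL X PUnit P (fun _ => 1) (fun _ _ => 1)
        = IL Y PUnit Q (fun _ => 1) (fun _ _ => 1) + IL X Y P Q S := by
    intro X Y _ _ P Q S h
    rw [← hcomp X Y PUnit P Q (fun _ => 1) S (fun _ _ => 1) h (hone Y Q h.2.2.1 h.2.2.2.1)]
    congr 1
    funext _ x
    simp [h.2.2.2.2.2.1 x]
  obtain ⟨c, hc⟩ := fad_main (fun X _ P => IL X PUnit P (fun _ => 1) (fun _ _ => 1))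
    (by
      refine hiso PUnit PUnit _ _ _ (hone _ _ (by simp) (by simp))
        ⟨fun _ _ => 1, hone _ _ (by simp) (by simp), by simp, by simp⟩)
    (by
      classical
      intro X Y _ _ e P Q hP hP1 hQ
      have hQ' : ∀ y, Q y = P (e.symm y) := fun y => by rw [← hQ, e.apply_symm_apply]
      have hQ0 : ∀ y, 0 ≤ Q y := fun y => by rw [hQ']; exact hP _
      have hQ1 : ∑ y, Q y = 1 := by
        rw [← hP1, ← Equiv.sum_comp e Q]; simp [hQ]
      have hS : IsStochMor P Q (fun y x => if x = e.symm y then (1 : ℝ) else 0) := by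
        refine ⟨hP, hP1, hQ0, hQ1, ?_, ?_, ?_⟩
        · intro x y; dsimp only; split_ifs <;> norm_num
        · intro x; simp [Equiv.eq_symm_apply]
        · intro y; simp [hQ']
      have hT : IsStochMor Q P (fun x y => if y = e x then (1 : ℝ) else 0) := by
        refine ⟨hQ0, hQ1, hP, hP1, ?_, ?_, ?_⟩
        · intro x y; dsimp only; split_ifs <;> norm_num
        · intro y; simp [← Equiv.symm_apply_eq]
        · intro x; simp [hQ]
      have := hdiff X Y P Q _ hS
      rw [this, hiso X Y P Q _ hS ⟨_, hT, ?_, ?_⟩, add_zero]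
      · intro x x'
        simp only [ite_mul, one_mul, zero_mul, Finset.sum_ite_eq', Finset.mem_univ, if_true,
          Equiv.symm_apply_apply, eq_comm (a := x)]
      · intro y y'
        simp only [ite_mul, one_mul, zero_mul, Finset.sum_ite_eq', Finset.mem_univ, if_true,
          Equiv.apply_symm_apply, eq_comm (a := y)])
    (by
      refine (hcont Bool PUnit).comp (f := fun l : ℝ =>
        ((fun b : Bool => if b then l else 1 - l), (fun _ => 1), (fun _ _ => 1))) ?_ ?_
      · refine Continuous.continuousOn (Continuous.prodMk (continuous_pi fun b => ?_)
          continuous_const)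
        cases b
        · simp only [Bool.false_eq_true, if_false]; fun_prop
        · simp only [if_true]; fun_prop
      · intro l hl
        refine hone Bool _ ?_ (by simp)
        intro b
        have h1 := hl.1
        have h2 := hl.2
        dsimp only
        split_ifs <;> linarith)
    (by
      intro X X' _ _ P P' l h0 h1 hP hP1 hP' hP1'
      have := hmix X X' PUnit P P' (fun _ => 1) (fun _ _ => 1) (fun _ _ => 1) l h0 h1
        (hone _ _ hP hP1) (hone _ _ hP' hP1')
      rw [← this]
      congr 1
      funext _ x
      cases x <;> rfl)
  refine ⟨-c, ?_⟩
  intro X Y _ _ P Q S h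
  have h1 := hdiff X Y P Q S h
  have h2 := hc X P h.1 h.2.1
  have h3 := hc Y Q h.2.2.1 h.2.2.2.1
  rw [h2, h3] at h1
  linear_combination -h1
end

section
/- Let T̃ assign a real number to every probability vector on every finite type, invariant under permutations of the entries (i.e. under bijections of the underlying finite types), with T̃ of the one-point probability vector equal to 0, and satisfying the binary extensivity property: T̃(λQ ⊕ (1−λ)Q') = T̃(λ, 1−λ) + λ T̃(Q) + (1−λ) T̃(Q') for all probability vectors Q, Q' and all λ ∈ [0,1]. Then T̃ satisfies the full additivity over subsystems: for any probability vector P : Fin (n+1) → ℝ and probability vectors Q_0, …, Q_n, the joint distribution (i, y) ↦ P i * Q_i y on the sigma type satisfies T̃(joint) = T̃(P) + ∑ i, P i * T̃(Q_i). -/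
/-- If `T̃` is a permutation-invariant functional on finite probability vectors that
vanishes on the one-point probability and satisfies binary extensivity
`T̃(λQ ⊕ (1−λ)Q') = T̃(λ, 1−λ) + λ T̃(Q) + (1−λ) T̃(Q')`, then it satisfies full
additivity over subsystems:
`T̃(joint) = T̃(P) + ∑ i, P i * T̃(Q_i)` for joint `(i, y) ↦ P i * Q_i y`. -/
theorem extensivity_implies_additivity_over_subsystems
    (T : ∀ (X : Type) [Fintype X], (X → ℝ) → ℝ)
    -- invariance under bijections of the underlying finite types
    (hinv : ∀ (X Y : Type) [Fintype X] [Fintype Y] (e : X ≃ Y) (Q : Y → ℝ),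
      (∀ y, 0 ≤ Q y) → (∑ y, Q y = 1) → T X (fun x => Q (e x)) = T Y Q)
    -- value 0 on the one-point probability vector
    (hone : T PUnit (fun _ => 1) = 0)
    -- binary extensivity
    (hext : ∀ (X X' : Type) [Fintype X] [Fintype X'] (Q : X → ℝ) (Q' : X' → ℝ)
      (l : ℝ), 0 ≤ l → l ≤ 1 →
      (∀ x, 0 ≤ Q x) → (∑ x, Q x = 1) → (∀ x, 0 ≤ Q' x) → (∑ x, Q' x = 1) →
      T (X ⊕ X') (Sum.elim (fun x => l * Q x) (fun x' => (1 - l) * Q' x'))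
        = T Bool (fun b => if b then l else 1 - l)
          + l * T X Q + (1 - l) * T X' Q')
    {n : ℕ} (Y : Fin (n + 1) → Type) [∀ i, Fintype (Y i)]
    (P : Fin (n + 1) → ℝ) (Q : ∀ i, Y i → ℝ)
    (hP0 : ∀ i, 0 ≤ P i) (hP1 : ∑ i, P i = 1)
    (hQ0 : ∀ i y, 0 ≤ Q i y) (hQ1 : ∀ i, ∑ y, Q i y = 1) :
    T ((i : Fin (n + 1)) × Y i) (fun z => P z.1 * Q z.1 z.2)
      = T (Fin (n + 1)) P + ∑ i, P i * T (Y i) (Q i) := by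
  have hjoint : ∀ (m : ℕ) (Z : Fin m → Type) [∀ i, Fintype (Z i)] (p : Fin m → ℝ)
      (q : ∀ i, Z i → ℝ), (∑ i, p i = 1) → (∀ i, ∑ y, q i y = 1) →
      ∑ z : (i : Fin m) × Z i, p z.1 * q z.1 z.2 = 1 := by
    intro m Z _ p q hp hq
    rw [Fintype.sum_sigma]
    simp only [← Finset.mul_sum, hq, mul_one, hp]
  induction n with
  | zero =>
    have hp : P 0 = 1 := by simpa using hP1
    have hs : ∑ i, P i * T (Y i) (Q i) = T (Y 0) (Q 0) := by simp [hp]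
    have : Unique (Fin (0 + 1)) := inferInstanceAs (Unique (Fin 1))
    let e : Y 0 ≃ ((i : Fin (0 + 1)) × Y i) := Equiv.ofBijective (fun y => ⟨0, y⟩) (by
      constructor
      · intro a b h
        simpa using h
      · rintro ⟨i, y⟩
        obtain rfl : i = 0 := Subsingleton.elim _ _
        exact ⟨y, rfl⟩)
    have h1 := hinv _ _ e (fun z => P z.1 * Q z.1 z.2)
      (fun z => mul_nonneg (hP0 _) (hQ0 _ _)) (hjoint _ _ _ _ hP1 hQ1)
    have h2 := hinv PUnit (Fin (0 + 1)) (Equiv.ofUnique _ _) P hP0 hP1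
    have h3 : (fun x : PUnit.{1} => P ((Equiv.ofUnique PUnit.{1} (Fin (0 + 1))) x)) = fun _ => 1 := by
      funext x
      rw [← hp]
      exact congrArg P (Subsingleton.elim _ _)
    rw [h3, hone] at h2
    have h4 : (fun x => P (e x).1 * Q (e x).1 (e x).2) = Q 0 := by
      funext y
      change P 0 * Q 0 y = Q 0 y
      rw [hp, one_mul]
    rw [h4] at h1
    rw [← h1, ← h2, hs]
    ring
  | succ n ih =>
    have hsum : P 0 + ∑ i : Fin (n + 1), P i.succ = 1 := by
      rw [← Fin.sum_univ_succ]; exact hP1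
    have hl1 : P 0 ≤ 1 := by
      have : 0 ≤ ∑ i : Fin (n + 1), P i.succ := Finset.sum_nonneg (fun i _ => hP0 _)
      linarith
    obtain ⟨P', hP'0, hP'1, hP'⟩ : ∃ P' : Fin (n + 1) → ℝ, (∀ i, 0 ≤ P' i) ∧ (∑ i, P' i = 1) ∧
        ∀ i, P i.succ = (1 - P 0) * P' i := by
      by_cases h : P 0 = 1
      · refine ⟨Pi.single 0 1, ?_, by simp, ?_⟩
        · intro i
          by_cases hi : i = 0
          · subst hi; simp
          · simp [hi]
        · intro i
          have h0 : ∑ i : Fin (n + 1), P i.succ = 0 := by linarith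
          have := (Finset.sum_eq_zero_iff_of_nonneg (fun i _ => hP0 (Fin.succ i))).1 h0 i
            (Finset.mem_univ _)
          rw [this, h]; simp
      · have hne : 1 - P 0 ≠ 0 := fun h' => h (by linarith)
        refine ⟨fun i => P i.succ / (1 - P 0), fun i => div_nonneg (hP0 _) (by linarith), ?_, ?_⟩
        · rw [← Finset.sum_div, div_eq_one_iff_eq hne]; linarith
        · intro i
          field_simp
    have IH := ih (fun i => Y i.succ) P' (fun i => Q i.succ) hP'0 hP'1
      (fun i => hQ0 _) (fun i => hQ1 _)
    let e : (Y 0 ⊕ ((i : Fin (n + 1)) × Y i.succ)) ≃ ((i : Fin (n + 1 + 1)) × Y i) :=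
      Equiv.ofBijective (Sum.elim (fun y => ⟨0, y⟩) (fun z => ⟨z.1.succ, z.2⟩)) (by
        constructor
        · rintro (a | ⟨i, a⟩) (b | ⟨j, b⟩) h
          · simpa using h
          · exact absurd (congrArg Sigma.fst h) (Fin.succ_ne_zero j).symm
          · exact absurd (congrArg Sigma.fst h) (Fin.succ_ne_zero i)
          · obtain rfl : i = j := Fin.succ_injective _ (congrArg Sigma.fst h)
            simpa using h
        · rintro ⟨i, y⟩
          induction i using Fin.cases with
          | zero => exact ⟨Sum.inl y, rfl⟩
          | succ i => exact ⟨Sum.inr ⟨i, y⟩, rfl⟩)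
    let f : (PUnit.{1} ⊕ Fin (n + 1)) ≃ Fin (n + 1 + 1) :=
      Equiv.ofBijective (Sum.elim (fun _ => 0) Fin.succ) (by
        constructor
        · rintro (a | i) (b | j) h
          · rfl
          · exact absurd h (Fin.succ_ne_zero j).symm
          · exact absurd h (Fin.succ_ne_zero i)
          · exact congrArg Sum.inr (Fin.succ_injective _ h)
        · intro i
          induction i using Fin.cases with
          | zero => exact ⟨Sum.inl PUnit.unit, rfl⟩
          | succ i => exact ⟨Sum.inr i, rfl⟩)
    have h1 := hinv _ _ e (fun z => P z.1 * Q z.1 z.2)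
      (fun z => mul_nonneg (hP0 _) (hQ0 _ _)) (hjoint _ _ _ _ hP1 hQ1)
    have h2 := hinv _ _ f P hP0 hP1
    have h3 : (fun x => P (e x).1 * Q (e x).1 (e x).2) =
        Sum.elim (fun x => P 0 * Q 0 x)
          (fun z => (1 - P 0) * (P' z.1 * Q z.1.succ z.2)) := by
      funext x
      rcases x with y | z
      · rfl
      · change P z.1.succ * Q z.1.succ z.2 = (1 - P 0) * (P' z.1 * Q z.1.succ z.2)
        rw [hP', mul_assoc]
    have h4 : (fun x => P (f x)) =
        Sum.elim (fun _ => P 0 * 1) (fun i => (1 - P 0) * P' i) := by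
      funext x
      rcases x with y | z
      · exact (mul_one (P 0)).symm
      · exact hP' z
    have h5 := hext _ _ (Q 0) (fun z : (i : Fin (n + 1)) × Y i.succ => P' z.1 * Q z.1.succ z.2)
      (P 0) (hP0 0) hl1 (hQ0 0) (hQ1 0) (fun z => mul_nonneg (hP'0 _) (hQ0 _ _))
      (hjoint _ (fun i => Y i.succ) P' (fun i => Q i.succ) hP'1 (fun i => hQ1 _))
    have h6 := hext PUnit (Fin (n + 1)) (fun _ => 1) P' (P 0) (hP0 0) hl1
      (fun _ => zero_le_one) (by simp) hP'0 hP'1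
    rw [h3, h5, IH] at h1
    rw [h4, h6, hone] at h2
    have h7 : ∑ i : Fin (n + 1), P i.succ * T (Y i.succ) (Q i.succ) =
        (1 - P 0) * ∑ i : Fin (n + 1), P' i * T (Y i.succ) (Q i.succ) := by
      rw [Finset.mul_sum]
      exact Finset.sum_congr rfl (fun i _ => by rw [hP', mul_assoc])
    rw [Fin.sum_univ_succ, h7, ← h1, ← h2]
    ring
end

section
/- Let N, M, K be positive natural numbers, let ρ' be an M×M complex matrix with Tr ρ' = 1, let ρ̃ be a K×K complex matrix, and let Φ₁ : (K×K) → (N×N) → ℂ and Φ₂ : (K×K) → (M×M) → ℂ be coefficient arrays with ∑_{a,b} (Φ₂)_{(u,s),(a,b)} ρ'_{ab} = ρ̃_{us} for all u, s. Define Ψ : ((N×N)×(M×M)) → (N×N) → ℂ by Ψ_{((i',j'),(a,b)),(i,j)} = (if i = i' ∧ j = j' then ρ'_{ab} else 0), and define Φ̃ : (K×K) → ((N×N)×(M×M)) → ℂ by Φ̃_{(u,s),((i,j),(a,b))} = (ρ̃_{us})⁻¹ * (Φ₁)_{(u,s),(i,j)} * (Φ₂)_{(u,s),(a,b)} when ρ̃_{us}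 ≠ 0, and Φ̃_{(u,s),((i,j),(a,b))} = (Φ₁)_{(u,s),(i,j)} * (if a = b then 1 else 0) + (Φ₂)_{(u,s),(a,b)} * (if i = j then 1 else 0) when ρ̃_{us} = 0. Then ∑_{(i',j'),(a,b)} Φ̃_{(u,s),((i',j'),(a,b))} * Ψ_{((i',j'),(a,b)),(i,j)} = (Φ₁)_{(u,s),(i,j)} for all u, s, i, j. -/
open Classical in
/-- The Choi-coefficient identity `Φ̃ ∘ Ψ = Φ₁` in the universal property of the
coproduct in the quantum probabilistic category: `Ψ` is the Choi array of
`ρ ↦ ρ ⊗ ρ'`, and `Φ̃` is built from `Φ₁`, `Φ₂` using the target density matrix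
`ρ̃`. -/
theorem choi_coproduct_composition {N M K : ℕ}
    (hN : 0 < N) (hM : 0 < M) (hK : 0 < K)
    (ρ' : Matrix (Fin M) (Fin M) ℂ) (hρ'tr : ρ'.trace = 1)
    (ρt : Matrix (Fin K) (Fin K) ℂ)
    (Φ₁ : (Fin K × Fin K) → (Fin N × Fin N) → ℂ)
    (Φ₂ : (Fin K × Fin K) → (Fin M × Fin M) → ℂ)
    (hΦ₂ : ∀ u s : Fin K, ∑ a : Fin M, ∑ b : Fin M,
      Φ₂ (u, s) (a, b) * ρ' a b = ρt u s) :
    ∀ (u s : Fin K) (i j : Fin N),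
      ∑ p : (Fin N × Fin N) × (Fin M × Fin M),
        (if ρt u s = 0 then
            Φ₁ (u, s) p.1 * (if p.2.1 = p.2.2 then 1 else 0)
              + Φ₂ (u, s) p.2 * (if p.1.1 = p.1.2 then 1 else 0)
          else (ρt u s)⁻¹ * Φ₁ (u, s) p.1 * Φ₂ (u, s) p.2)
        * (if i = p.1.1 ∧ j = p.1.2 then ρ' p.2.1 p.2.2 else 0)
      = Φ₁ (u, s) (i, j) := by
  intro u s i j
  rw [Fintype.sum_prod_type, Finset.sum_eq_single (i, j)]
  · have h2 := hΦ₂ u s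
    rw [← Fintype.sum_prod_type' (f := fun a b => Φ₂ (u, s) (a, b) * ρ' a b)] at h2
    have h1 : ∑ q : Fin M × Fin M, (if q.1 = q.2 then (1 : ℂ) else 0) * ρ' q.1 q.2 = 1 := by
      refine Eq.trans ?_ hρ'tr
      rw [Fintype.sum_prod_type]
      simp [Matrix.trace]
    by_cases h : ρt u s = 0
    · simp only [h, if_true, and_self]
      rw [h] at h2
      calc _ = Φ₁ (u, s) (i, j) *
              (∑ q : Fin M × Fin M, (if q.1 = q.2 then (1 : ℂ) else 0) * ρ' q.1 q.2)
            + (if i = j then (1 : ℂ) else 0) *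
              ∑ q : Fin M × Fin M, Φ₂ (u, s) (q.1, q.2) * ρ' q.1 q.2 := by
            rw [Finset.mul_sum, Finset.mul_sum, ← Finset.sum_add_distrib]
            refine Finset.sum_congr rfl fun q _ => ?_
            ring
        _ = _ := by rw [h1, h2]; ring
    · simp only [h, if_false, if_true, and_self]
      calc _ = (ρt u s)⁻¹ * Φ₁ (u, s) (i, j) *
              ∑ q : Fin M × Fin M, Φ₂ (u, s) (q.1, q.2) * ρ' q.1 q.2 := by
            rw [Finset.mul_sum]
            refine Finset.sum_congr rfl fun q _ => ?_
            ring
        _ = _ := by rw [h2]; field_simp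
  · intro b _ hb
    refine Finset.sum_eq_zero fun q _ => ?_
    rw [if_neg (c := i = _ ∧ j = _), mul_zero]
    rintro ⟨h, h'⟩
    exact hb (Prod.ext h.symm h'.symm)
  · intro h
    exact absurd (Finset.mem_univ _) h
end
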